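/- arXiv:1201.0276 — 2 statements merged into one kernel-verified Lean document; each statement's English description precedes it below -/
import Mathlib

section
/- Let A = {−1,1}. For every integer a ≥ 1, 16·3^a − 15 ≤ s_A(C_{3^a}^5) ≤ 22·3^a − 21; that is, every sequence over C_{3^a}^5 of length at least 22·3^a − 21 has an A-zero-sum subsequence of length 3^a, and there exists a sequence over C_{3^a}^5 of length 16·3^a − 16 with no A-zero-sum subsequence of length 3^a. -/
/-- A multiset `S` over an additive abelian group `G` has an `A`-zero-sum subsequence
of length `k`, for the weight set `A = {-1, 1}`: there is a sub-multiset of `S` of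
cardinality `k` that splits as `t₁ + t₂` with `t₁.sum - t₂.sum = 0` (the elements of
`t₁` receive the weight `+1` and those of `t₂` the weight `-1`). -/
def HasWZSS {G : Type*} [AddCommGroup G] (S : Multiset G) (k : ℕ) : Prop :=
  ∃ t₁ t₂ : Multiset G, t₁ + t₂ ≤ S ∧ Multiset.card (t₁ + t₂) = k ∧ t₁.sum = t₂.sum

/-- `sA G` is the smallest `ℓ` such that every sequence over `G` of length at least `ℓ`
has an `{-1,1}`-zero-sum subsequence of length `exp G`. -/
noncomputable def sA (G : Type*) [AddCommGroup G] : ℕ :=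
  sInf {ℓ : ℕ | ∀ S : Multiset G, ℓ ≤ Multiset.card S →
    HasWZSS S (AddMonoid.exponent G)}

/-- `etaA G` is the smallest `ℓ` such that every sequence over `G` of length at least `ℓ`
has a nonempty `{-1,1}`-zero-sum subsequence of length at most `exp G`. -/
noncomputable def etaA (G : Type*) [AddCommGroup G] : ℕ :=
  sInf {ℓ : ℕ | ∀ S : Multiset G, ℓ ≤ Multiset.card S →
    ∃ k, 1 ≤ k ∧ k ≤ AddMonoid.exponent G ∧ HasWZSS S k}

/-- `gA G` is the smallest `ℓ` such that every sequence over `G` of length at least `ℓ`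
consisting of pairwise distinct elements has an `{-1,1}`-zero-sum subsequence of
length `exp G`. -/
noncomputable def gA (G : Type*) [AddCommGroup G] : ℕ :=
  sInf {ℓ : ℕ | ∀ S : Multiset G, ℓ ≤ Multiset.card S → S.Nodup →
    HasWZSS S (AddMonoid.exponent G)}


abbrev V5 := Fin 5 → ZMod 3

/-- indicator of zero -/
def Iz (a : ZMod 3) : ℤ := if a = 0 then 1 else 0

/-- cap condition (up to sign) -/
def IsCap (C : Finset V5) : Prop :=
  (∀ x ∈ C, x ≠ 0) ∧ (∀ x ∈ C, ∀ y ∈ C, x ≠ y → x ≠ -y) ∧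
  (∀ x ∈ C, ∀ y ∈ C, ∀ z ∈ C, x ≠ y → x ≠ z → y ≠ z →
    x + y + z ≠ 0 ∧ x + y - z ≠ 0 ∧ x - y + z ≠ 0 ∧ x - y - z ≠ 0)

lemma IsCap.mono {C D : Finset V5} (h : IsCap C) (hD : D ⊆ C) : IsCap D :=
  ⟨fun x hx => h.1 x (hD hx), fun x hx y hy => h.2.1 x (hD hx) y (hD hy),
   fun x hx y hy z hz => h.2.2 x (hD hx) y (hD hy) z (hD hz)⟩

lemma z3_cases (a : ZMod 3) : a = 0 ∨ a = 1 ∨ a = -1 := by revert a; decide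

lemma li1 {x : V5} (hx : x ≠ 0) : LinearIndependent (ZMod 3) ![x] := by
  rw [Fintype.linearIndependent_iff]
  intro g hg i
  simp at hg
  fin_cases i
  simpa using hg.resolve_right hx

lemma li2 {x y : V5} (hx : x ≠ 0) (hy : y ≠ 0) (h1 : x ≠ y) (h2 : x ≠ -y) :
    LinearIndependent (ZMod 3) ![x, y] := by
  rw [LinearIndependent.pair_iff]
  intro s t h
  rcases z3_cases s with rfl | rfl | rfl <;> rcases z3_cases t with rfl | rfl | rfl <;>
    simp at h ⊢ <;> grind

lemma IsCap.li3 {C : Finset V5} (h : IsCap C) {x y z : V5} (hx : x ∈ C) (hy : y ∈ C) (hz : z ∈ C)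
    (h1 : x ≠ y) (h2 : x ≠ z) (h3 : y ≠ z) :
    LinearIndependent (ZMod 3) ![x, y, z] := by
  rw [Fintype.linearIndependent_iff]
  intro g hg
  simp only [Fin.sum_univ_three, Matrix.cons_val] at hg
  have hh := h.2.2 x hx y hy z hz h1 h2 h3
  have a1 := h.1 x hx
  have a2 := h.1 y hy
  have a3 := h.1 z hz
  have b1 := h.2.1 x hx y hy h1
  have b2 := h.2.1 x hx z hz h2
  have b3 := h.2.1 y hy z hz h3
  have : g 0 = 0 ∧ g 1 = 0 ∧ g 2 = 0 := by
    rcases z3_cases (g 0) with e0 | e0 | e0 <;> rcases z3_cases (g 1) with e1 | e1 | e1 <;>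
    rcases z3_cases (g 2) with e2 | e2 | e2 <;> rw [e0, e1, e2] at hg <;>
    simp at hg <;> grind
  intro i
  fin_cases i
  · exact this.1
  · exact this.2.1
  · exact this.2.2

lemma card_perp {n : ℕ} (v : Fin n → V5) (hv : LinearIndependent (ZMod 3) v) :
    (Finset.univ.filter (fun g : V5 => ∀ i, g ⬝ᵥ v i = 0)).card = 3 ^ (5 - n) := by
  let M : Matrix (Fin n) (Fin 5) (ZMod 3) := Matrix.of v
  have hr : M.rank = n := by
    have := LinearIndependent.rank_matrix (M := M) hv
    simpa using this
  have h1 := LinearMap.finrank_range_add_finrank_ker (M.mulVecLin)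
  rw [show Module.finrank (ZMod 3) (LinearMap.range M.mulVecLin) = n from hr] at h1
  simp at h1
  have h2 : Module.finrank (ZMod 3) (LinearMap.ker M.mulVecLin) = 5 - n := by omega
  have h3 := Module.natCard_eq_pow_finrank (K := ZMod 3) (V := LinearMap.ker M.mulVecLin)
  rw [h2] at h3
  rw [Nat.card_zmod] at h3
  rw [← h3, ← Fintype.card_subtype, ← Nat.card_eq_fintype_card]
  apply Nat.card_congr
  apply Equiv.subtypeEquivRight
  intro g
  rw [LinearMap.mem_ker, Matrix.mulVecLin_apply, funext_iff]
  simp [M, Matrix.mulVec, dotProduct_comm]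

/-- number of points of C in the hyperplane of g -/
def mm (C : Finset V5) (g : V5) : ℤ := ∑ x ∈ C, Iz (g ⬝ᵥ x)

lemma Iz_mul3 (a b c : ZMod 3) : Iz a * Iz b * Iz c = if a = 0 ∧ b = 0 ∧ c = 0 then 1 else 0 := by
  revert a b c; decide

lemma Nfun {C : Finset V5} (h : IsCap C) {x y z : V5} (hx : x ∈ C) (hy : y ∈ C) (hz : z ∈ C) :
    ∑ g : V5, Iz (g ⬝ᵥ x) * Iz (g ⬝ᵥ y) * Iz (g ⬝ᵥ z) =
      9 + 18 * ((if x = y then 1 else 0) + (if x = z then 1 else 0) + (if y = z then 1 else 0))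
      + 18 * ((if x = y then 1 else 0) * (if x = z then 1 else 0)) := by
  simp only [Iz_mul3]
  rw [Finset.sum_boole]
  have c1 : ∀ x ∈ C, (Finset.univ.filter (fun g : V5 => g ⬝ᵥ x = 0)).card = 81 := by
    intro x hx
    have := card_perp _ (li1 (h.1 x hx))
    simpa using this
  have c2 : ∀ x ∈ C, ∀ y ∈ C, x ≠ y →
      (Finset.univ.filter (fun g : V5 => g ⬝ᵥ x = 0 ∧ g ⬝ᵥ y = 0)).card = 27 := by
    intro x hx y hy hxy
    have := card_perp _ (li2 (h.1 x hx) (h.1 y hy) hxy (h.2.1 x hx y hy hxy))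
    simpa [Fin.forall_fin_two] using this
  by_cases e1 : x = y
  · subst e1
    by_cases e2 : x = z
    · subst e2
      simp [c1 x hx]
    · simp [e2, c2 x hx z hz e2]
  · by_cases e2 : x = z
    · subst e2
      have := c2 x hx y hy e1
      have e : (Finset.univ.filter (fun g : V5 => g ⬝ᵥ x = 0 ∧ g ⬝ᵥ y = 0 ∧ g ⬝ᵥ x = 0)) =
        (Finset.univ.filter (fun g : V5 => g ⬝ᵥ x = 0 ∧ g ⬝ᵥ y = 0)) := by
        ext g; simp; tauto
      rw [e, this]
      simp [e1, Ne.symm e1]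
    · by_cases e3 : y = z
      · subst e3
        simp [e1, c2 x hx y hy e1]
      · have := card_perp _ (h.li3 hx hy hz e1 e2 e3)
        simp only [Fin.forall_fin_succ, Matrix.cons_val_zero, Matrix.cons_val_succ] at this
        simp at this
        simp [e1, e2, e3, this]

lemma Iz_idem (a : ZMod 3) : Iz a * Iz a = Iz a := by revert a; decide
lemma Iz_idem3 (a : ZMod 3) : Iz a * Iz a * Iz a = Iz a := by revert a; decide

lemma N2 {C : Finset V5} (h : IsCap C) {x y : V5} (hx : x ∈ C) (hy : y ∈ C) :
    ∑ g : V5, Iz (g ⬝ᵥ x) * Iz (g ⬝ᵥ y) = 27 + 54 * (if x = y then 1 else 0) := by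
  have := Nfun h hx hx hy
  simp only [Iz_idem] at this
  rw [this]
  split_ifs <;> simp_all

lemma N1 {C : Finset V5} (h : IsCap C) {x : V5} (hx : x ∈ C) :
    ∑ g : V5, Iz (g ⬝ᵥ x) = 81 := by
  have := Nfun h hx hx hx
  simp only [Iz_idem] at this
  rw [this]; simp

lemma Q1 {C : Finset V5} (h : IsCap C) {x : V5} (hx : x ∈ C) :
    ∑ g : V5, Iz (g ⬝ᵥ x) * mm C g = 27 * C.card + 54 := by
  simp only [mm, Finset.mul_sum]
  rw [Finset.sum_comm]
  rw [Finset.sum_congr rfl (fun y hy => N2 h hx hy)]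
  simp [Finset.sum_add_distrib, hx]
  ring

lemma Q2 {C : Finset V5} (h : IsCap C) {x : V5} (hx : x ∈ C) :
    ∑ g : V5, Iz (g ⬝ᵥ x) * mm C g ^ 2 = 9 * C.card ^ 2 + 54 * C.card + 18 := by
  have : ∀ g, Iz (g ⬝ᵥ x) * mm C g ^ 2 =
      ∑ y ∈ C, ∑ z ∈ C, Iz (g ⬝ᵥ x) * Iz (g ⬝ᵥ y) * Iz (g ⬝ᵥ z) := by
    intro g
    rw [mm, sq, Finset.sum_mul_sum, Finset.mul_sum]
    simp only [Finset.mul_sum, mul_assoc]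
  simp only [this]
  rw [Finset.sum_comm]
  have : ∀ y ∈ C, ∑ g : V5, ∑ z ∈ C, Iz (g ⬝ᵥ x) * Iz (g ⬝ᵥ y) * Iz (g ⬝ᵥ z) =
      9 * C.card + 36 + (18 * C.card + 18) * (if x = y then 1 else 0) := by
    intro y hy
    rw [Finset.sum_comm, Finset.sum_congr rfl (fun z hz => Nfun h hx hy hz)]
    by_cases e : x = y
    · subst e
      simp [Finset.sum_add_distrib, hx, ← Finset.mul_sum]
      ring
    · simp [Finset.sum_add_distrib, hx, hy, ← Finset.mul_sum, e]
      ring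
  rw [Finset.sum_congr rfl this]
  simp [Finset.sum_add_distrib, hx, ← Finset.mul_sum]
  ring

lemma M1 {C : Finset V5} (h : IsCap C) : ∑ g : V5, mm C g = 81 * C.card := by
  simp only [mm]
  rw [Finset.sum_comm, Finset.sum_congr rfl (fun y hy => N1 h hy)]
  simp; ring

lemma M2 {C : Finset V5} (h : IsCap C) : ∑ g : V5, mm C g ^ 2 = 27 * C.card ^ 2 + 54 * C.card := by
  have : ∀ g, mm C g ^ 2 = ∑ x ∈ C, Iz (g ⬝ᵥ x) * mm C g := by
    intro g; rw [← Finset.sum_mul, sq]; rfl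
  simp only [this]
  rw [Finset.sum_comm, Finset.sum_congr rfl (fun y hy => Q1 h hy)]
  simp; ring

lemma M3 {C : Finset V5} (h : IsCap C) :
    ∑ g : V5, mm C g ^ 3 = 9 * C.card ^ 3 + 54 * C.card ^ 2 + 18 * C.card := by
  have : ∀ g, mm C g ^ 3 = ∑ x ∈ C, Iz (g ⬝ᵥ x) * mm C g ^ 2 := by
    intro g; rw [← Finset.sum_mul, pow_succ' _ 2]; rfl
  simp only [this]
  rw [Finset.sum_comm, Finset.sum_congr rfl (fun y hy => Q2 h hy)]
  simp; ring

lemma mm_zero (C : Finset V5) : mm C 0 = C.card := by simp [mm, Iz]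

lemma mm_neg (C : Finset V5) (g : V5) : mm C (-g) = mm C g := by
  simp [mm, Iz]

lemma mm_nonneg (C : Finset V5) (g : V5) : 0 ≤ mm C g :=
  Finset.sum_nonneg fun x _ => by unfold Iz; split_ifs <;> norm_num

/-- the part of `C` in the hyperplane `f` -/
def sec (C : Finset V5) (f : V5) : Finset V5 := C.filter (fun x => f ⬝ᵥ x = 0)

lemma sec_sub (C : Finset V5) (f : V5) : sec C f ⊆ C := Finset.filter_subset _ _

lemma sec_card (C : Finset V5) (f : V5) : ((sec C f).card : ℤ) = mm C f := by
  simp [sec, mm, Iz]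

lemma mm_sec (C : Finset V5) (f g : V5) :
    mm (sec C f) g = ∑ x ∈ C, Iz (f ⬝ᵥ x) * Iz (g ⬝ᵥ x) := by
  simp only [sec, mm, Finset.sum_filter]
  apply Finset.sum_congr rfl
  intro x _
  by_cases h : f ⬝ᵥ x = 0 <;> simp [h, Iz]

lemma mm_sec_self (C : Finset V5) (f : V5) : mm (sec C f) f = mm C f := by
  rw [mm_sec]; simp only [Iz_idem, mm]

lemma mm_sec_comm (C : Finset V5) (f g : V5) : mm (sec C f) g = mm (sec C g) f := by
  simp only [mm_sec, mul_comm]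

lemma mm_sec_add (C : Finset V5) (f g : V5) : mm (sec C f) (g + f) = mm (sec C f) g := by
  simp only [mm_sec, add_dotProduct]
  apply Finset.sum_congr rfl
  intro x _
  generalize f ⬝ᵥ x = a
  generalize g ⬝ᵥ x = b
  revert a b; decide

lemma mm_sec_sub (C : Finset V5) (f g : V5) : mm (sec C f) (g - f) = mm (sec C f) g := by
  have := mm_sec_add C f (g - f)
  rw [sub_add_cancel] at this
  exact this.symm

lemma pencil (C : Finset V5) (f g : V5) :
    mm C f + mm C g + mm C (g + f) + mm C (g - f) = C.card + 3 * mm (sec C f) g := by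
  rw [mm_sec, Finset.mul_sum, Finset.card_eq_sum_ones]
  push_cast
  simp only [mm, ← Finset.sum_add_distrib, add_dotProduct, sub_dotProduct]
  apply Finset.sum_congr rfl
  intro x _
  generalize f ⬝ᵥ x = a
  generalize g ⬝ᵥ x = b
  revert a b; decide

/-- functionals not proportional to f -/
def off (f : V5) : Finset V5 := Finset.univ.filter (fun g => g ≠ 0 ∧ g ≠ f ∧ g ≠ -f)

lemma mem_off {f g : V5} : g ∈ off f ↔ g ≠ 0 ∧ g ≠ f ∧ g ≠ -f := by simp [off]

lemma ne_neg5 {f : V5} (hf : f ≠ 0) : f ≠ -f := by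
  intro h
  apply hf
  funext i
  have := congrFun h i
  simp only [Pi.neg_apply] at this
  show f i = 0
  generalize f i = a at *
  revert a; decide

lemma three5 (f : V5) : f + f + f = 0 := by
  funext i
  show f i + f i + f i = 0
  generalize f i = a
  revert a; decide

lemma sum_off {f : V5} (hf : f ≠ 0) (F : V5 → ℤ) :
    ∑ g : V5, F g = (F 0 + F f + F (-f)) + ∑ g ∈ off f, F g := by
  have h1 : (Finset.univ : Finset V5) = insert 0 (insert f (insert (-f) (off f))) := by
    ext g; simp [mem_off]; tauto
  have h2 := ne_neg5 hf
  rw [h1, Finset.sum_insert, Finset.sum_insert, Finset.sum_insert]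
  · ring
  · simp [mem_off]
  · simp [mem_off, h2]
  · simp [mem_off, hf, Ne.symm hf, eq_comm]

lemma card_off {f : V5} (hf : f ≠ 0) : ((off f).card : ℤ) = 240 := by
  have := sum_off hf (fun _ => 1)
  simp at this
  linarith

lemma off_add {f g : V5} (hg : g ∈ off f) : g + f ∈ off f := by
  rw [mem_off] at *
  have := three5 f
  grind

lemma off_sub {f g : V5} (hg : g ∈ off f) : g - f ∈ off f := by
  rw [mem_off] at *
  have := three5 f
  grind

lemma off_comm {f g : V5} (hf : f ≠ 0) (hg : g ∈ off f) : f ∈ off g := by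
  rw [mem_off] at *
  grind

lemma IsCap.comb {C : Finset V5} (h : IsCap C) {x y z : V5} (hx : x ∈ C) (hy : y ∈ C) (hz : z ∈ C)
    (h1 : x ≠ y) (h2 : x ≠ z) (h3 : y ≠ z) (s t : ZMod 3) : x + s • y + t • z ≠ 0 := by
  intro hh
  have := Fintype.linearIndependent_iff.1 (h.li3 hx hy hz h1 h2 h3) ![1, s, t]
    (by simpa [Fin.sum_univ_three] using hh) 0
  simp at this

set_option synthInstance.maxSize 2000 in
set_option synthInstance.maxHeartbeats 400000 in
set_option maxRecDepth 100000 in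
lemma sign_pigeon : ∀ a b c a' b' c' : ZMod 3, a ≠ 0 → b ≠ 0 → c ≠ 0 → a' ≠ 0 → b' ≠ 0 → c' ≠ 0 →
    ∃ s, (a + s * a' = 0 ∧ b + s * b' = 0) ∨ (a + s * a' = 0 ∧ c + s * c' = 0) ∨
      (b + s * b' = 0 ∧ c + s * c' = 0) := by decide

/-- A plane contains at most 4 points of a cap. -/
lemma plane_le {C : Finset V5} (h : IsCap C) {f g : V5} (hf : f ≠ 0) (hg : g ∈ off f)
    (h1 : ∀ x ∈ C, f ⬝ᵥ x = 0) (h2 : ∀ x ∈ C, g ⬝ᵥ x = 0) : C.card ≤ 4 := by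
  by_contra hc
  push Not at hc
  obtain ⟨D, hD, hDc⟩ := Finset.exists_subset_card_eq (show 5 ≤ C.card by omega)
  obtain ⟨e⟩ : Nonempty (Fin 5 ≃ D) := ⟨(Finset.equivFinOfCardEq hDc).symm⟩
  obtain ⟨v, hv, hinj⟩ : ∃ v : Fin 5 → V5, (∀ i, v i ∈ C) ∧ ∀ i j, i ≠ j → v i ≠ v j :=
    ⟨fun i => e i, fun i => hD (e i).2, fun i j hij hh => hij (e.injective (Subtype.ext hh))⟩
  have hli := h.li3 (hv 0) (hv 1) (hv 2) (hinj _ _ (by decide)) (hinj _ _ (by decide))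
    (hinj _ _ (by decide))
  obtain ⟨g1, g2, g3⟩ := mem_off.1 (off_comm hf hg)
  have hW := card_perp _ (li2 hf (mem_off.1 hg).1 g2 g3)
  have key : ∀ u ∈ C, ∃ a b c : ZMod 3, u = a • v 0 + b • v 1 + c • v 2 := by
    have himg : (Finset.univ : Finset (Fin 3 → ZMod 3)).image
        (fun c => ∑ i, c i • (![v 0, v 1, v 2] i)) =
        Finset.univ.filter (fun x : V5 => ∀ i, x ⬝ᵥ (![f, g] i) = 0) := by
      apply Finset.eq_of_subset_of_card_le
      · intro x hx
        simp only [Finset.mem_image, Finset.mem_univ, true_and] at hx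
        obtain ⟨c, rfl⟩ := hx
        simp [Fin.forall_fin_two, Fin.sum_univ_three, dotProduct_comm _ f, dotProduct_comm _ g,
          h1 _ (hv _), h2 _ (hv _)]
      · rw [hW, Finset.card_image_of_injective]
        · simp
        · intro c d hcd
          have := Fintype.linearIndependent_iff.1 hli (c - d)
            (by simpa [sub_smul, sub_eq_zero] using hcd)
          funext i
          exact sub_eq_zero.1 (this i)
    intro u hu
    have : u ∈ Finset.univ.filter (fun x : V5 => ∀ i, x ⬝ᵥ (![f, g] i) = 0) := by
      simp [Fin.forall_fin_two, dotProduct_comm u, h1 u hu, h2 u hu]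
    rw [← himg] at this
    simp only [Finset.mem_image, Finset.mem_univ, true_and] at this
    obtain ⟨c, rfl⟩ := this
    exact ⟨c 0, c 1, c 2, by simp [Fin.sum_univ_three]⟩
  have comb : ∀ i j k : Fin 5, i ≠ j → i ≠ k → j ≠ k → ∀ s t : ZMod 3,
      v i + s • v j + t • v k ≠ 0 := fun i j k hij hik hjk s t =>
    h.comb (hv i) (hv j) (hv k) (hinj _ _ hij) (hinj _ _ hik) (hinj _ _ hjk) s t
  have nz : ∀ i : Fin 5, i ≠ 0 → i ≠ 1 → i ≠ 2 → ∀ a b c : ZMod 3,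
      v i = a • v 0 + b • v 1 + c • v 2 → a ≠ 0 ∧ b ≠ 0 ∧ c ≠ 0 := by
    intro i i0 i1 i2 a b c hi
    refine ⟨?_, ?_, ?_⟩ <;> rintro rfl
    · apply comb i 1 2 i1 i2 (by decide) (-b) (-c)
      rw [hi]; module
    · apply comb i 0 2 i0 i2 (by decide) (-a) (-c)
      rw [hi]; module
    · apply comb i 0 1 i0 i1 (by decide) (-a) (-b)
      rw [hi]; module
  obtain ⟨a, b, c, e3⟩ := key _ (hv 3)
  obtain ⟨a', b', c', e4⟩ := key _ (hv 4)
  obtain ⟨na, nb, nc⟩ := nz 3 (by decide) (by decide) (by decide) a b c e3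
  obtain ⟨na', nb', nc'⟩ := nz 4 (by decide) (by decide) (by decide) a' b' c' e4
  have lin : ∀ s : ZMod 3, v 3 + s • v 4 =
      (a + s * a') • v 0 + (b + s * b') • v 1 + (c + s * c') • v 2 := by
    intro s; rw [e3, e4]; module
  obtain ⟨s, hs⟩ := sign_pigeon a b c a' b' c' na nb nc na' nb' nc'
  rcases hs with ⟨s1, s2⟩ | ⟨s1, s2⟩ | ⟨s1, s2⟩
  · apply comb 3 4 2 (by decide) (by decide) (by decide) s (-(c + s * c'))
    rw [lin, s1, s2]; module
  · apply comb 3 4 1 (by decide) (by decide) (by decide) s (-(b + s * b'))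
    rw [lin, s1, s2]; module
  · apply comb 3 4 0 (by decide) (by decide) (by decide) s (-(a + s * a'))
    rw [lin, s1, s2]; module

lemma IsCap.sec {C : Finset V5} (h : IsCap C) (f : V5) : IsCap (sec C f) := h.mono (sec_sub C f)

lemma p_le {C : Finset V5} (h : IsCap C) {f g : V5} (hf : f ≠ 0) (hg : g ∈ off f) :
    mm (_root_.sec C f) g ≤ 4 := by
  rw [← sec_card]
  have := plane_le ((h.sec f).sec g) hf hg
    (fun x hx => (Finset.mem_filter.1 (sec_sub _ _ hx)).2) (fun x hx => (Finset.mem_filter.1 hx).2)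
  exact_mod_cast this

/-- moments over `off f` for the section by `f` -/
lemma M0o {f : V5} (hf : f ≠ 0) : ∑ _g ∈ off f, (1 : ℤ) = 240 := by
  rw [← card_off hf]; simp

lemma M1o {C : Finset V5} (h : IsCap C) {f : V5} (hf : f ≠ 0) :
    ∑ g ∈ off f, mm (sec C f) g = 78 * mm C f := by
  have := M1 (h.sec f)
  rw [sum_off hf, mm_zero, mm_neg, mm_sec_self, sec_card] at this
  linarith

lemma M2o {C : Finset V5} (h : IsCap C) {f : V5} (hf : f ≠ 0) :
    ∑ g ∈ off f, mm (sec C f) g ^ 2 = 24 * mm C f ^ 2 + 54 * mm C f := by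
  have := M2 (h.sec f)
  rw [sum_off hf, mm_zero, mm_neg, mm_sec_self, sec_card] at this
  linarith

lemma M3o {C : Finset V5} (h : IsCap C) {f : V5} (hf : f ≠ 0) :
    ∑ g ∈ off f, mm (sec C f) g ^ 3 = 6 * mm C f ^ 3 + 54 * mm C f ^ 2 + 18 * mm C f := by
  have := M3 (h.sec f)
  rw [sum_off hf, mm_zero, mm_neg, mm_sec_self, sec_card] at this
  linarith

/-- A solid contains at most 10 points of a cap. -/
lemma solid_le {C : Finset V5} (h : IsCap C) {f : V5} (hf : f ≠ 0) : mm C f ≤ 10 := by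
  have h1 : 0 ≤ ∑ g ∈ off f, (mm (sec C f) g * (mm (sec C f) g - 1) * (4 - mm (sec C f) g)) := by
    apply Finset.sum_nonneg
    intro g hg
    have a := p_le h hf hg
    have b := mm_nonneg (sec C f) g
    generalize mm (sec C f) g = m at *
    interval_cases m <;> norm_num
  have h2 : ∑ g ∈ off f, (mm (sec C f) g * (mm (sec C f) g - 1) * (4 - mm (sec C f) g)) =
    5 * (∑ g ∈ off f, mm (sec C f) g ^ 2) - (∑ g ∈ off f, mm (sec C f) g ^ 3)
      - 4 * (∑ g ∈ off f, mm (sec C f) g) := by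
    rw [Finset.mul_sum, Finset.mul_sum, ← Finset.sum_sub_distrib, ← Finset.sum_sub_distrib]
    apply Finset.sum_congr rfl
    intros; ring
  rw [h2, M1o h hf, M2o h hf, M3o h hf] at h1
  by_contra hc
  push Not at hc
  nlinarith [mul_pos (show 0 < mm C f - 10 by linarith)
    (mul_pos (show 0 < mm C f by linarith) (show 0 < mm C f - 1 by linarith))]

/-- Sections of a 10-point solid have 1 or 4 points. -/
lemma ten {C : Finset V5} (h : IsCap C) {f : V5} (hf : f ≠ 0) (h10 : mm C f = 10)
    {g : V5} (hg : g ∈ off f) : mm (sec C f) g = 1 ∨ mm (sec C f) g = 4 := by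
  have e1 := M1o h hf
  have e2 := M2o h hf
  have e3 := M3o h hf
  rw [h10] at e1 e2 e3
  -- nonnegative sums that vanish
  have pos1 : ∀ g ∈ off f, 0 ≤ (mm (sec C f) g * (mm (sec C f) g - 1) * (4 - mm (sec C f) g)) := by
    intro g hg
    have a := p_le h hf hg
    have b := mm_nonneg (sec C f) g
    generalize mm (sec C f) g = m at *
    interval_cases m <;> norm_num
  have z1 : ∑ g ∈ off f, (mm (sec C f) g * (mm (sec C f) g - 1) * (4 - mm (sec C f) g)) = 0 := by
    have h2 : ∑ g ∈ off f, (mm (sec C f) g * (mm (sec C f) g - 1) * (4 - mm (sec C f) g)) =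
      5 * (∑ g ∈ off f, mm (sec C f) g ^ 2) - (∑ g ∈ off f, mm (sec C f) g ^ 3)
        - 4 * (∑ g ∈ off f, mm (sec C f) g) := by
      rw [Finset.mul_sum, Finset.mul_sum, ← Finset.sum_sub_distrib, ← Finset.sum_sub_distrib]
      apply Finset.sum_congr rfl
      intros; ring
    rw [h2, e1, e2, e3]; norm_num
  have w1 := (Finset.sum_eq_zero_iff_of_nonneg pos1).1 z1
  have c1 : ∀ g ∈ off f, mm (sec C f) g = 0 ∨ mm (sec C f) g = 1 ∨ mm (sec C f) g = 4 := by
    intro g hg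
    have := w1 g hg
    simp only [mul_eq_zero] at this
    omega
  have pos2 : ∀ g ∈ off f, 0 ≤ (mm (sec C f) g - 1) * (mm (sec C f) g - 4) := by
    intro g hg
    rcases c1 g hg with e | e | e <;> rw [e] <;> norm_num
  have z2 : ∑ g ∈ off f, (mm (sec C f) g - 1) * (mm (sec C f) g - 4) = 0 := by
    have h2 : ∑ g ∈ off f, (mm (sec C f) g - 1) * (mm (sec C f) g - 4) =
      (∑ g ∈ off f, mm (sec C f) g ^ 2) - 5 * (∑ g ∈ off f, mm (sec C f) g)
        + 4 * (∑ g ∈ off f, 1) := by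
      rw [Finset.mul_sum, Finset.mul_sum, ← Finset.sum_sub_distrib, ← Finset.sum_add_distrib]
      apply Finset.sum_congr rfl
      intros; ring
    rw [h2, e1, e2, M0o hf]; norm_num
  have w2 := (Finset.sum_eq_zero_iff_of_nonneg pos2).1 z2 g hg
  simp only [mul_eq_zero] at w2
  omega

lemma ten' {C : Finset V5} (h : IsCap C) {f g : V5} (hf : f ≠ 0) (hg : g ∈ off f)
    (h10 : mm C g = 10) : mm (sec C f) g = 1 ∨ mm (sec C f) g = 4 := by
  rw [mm_sec_comm]
  exact ten h (mem_off.1 hg).1 h10 (off_comm hf hg)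

/-- Small solids have at most 2 points. -/
lemma small {C : Finset V5} (h : IsCap C) (hC : C.card = 23) {f : V5} (hf : f ≠ 0)
    (h4 : mm C f ≤ 4) : mm C f ≤ 2 := by
  by_contra hc
  push Not at hc
  have h3 : 2 < (sec C f).card := by have := sec_card C f; omega
  obtain ⟨x, y, z, hx, hy, hz, hxy, hxz, hyz⟩ := Finset.two_lt_card_iff.1 h3
  -- g vanishing on x, y, z not proportional to f
  have hN := card_perp _ ((h.sec f).li3 hx hy hz hxy hxz hyz)
  obtain ⟨g, hg, hgf⟩ : ∃ g ∈ Finset.univ.filter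
      (fun g : V5 => ∀ i, g ⬝ᵥ (![x, y, z] i) = 0), g ∉ ({0, f, -f} : Finset V5) := by
    apply Finset.exists_mem_notMem_of_card_lt_card
    rw [hN]
    exact lt_of_le_of_lt Finset.card_le_three (by norm_num)
  have hgo : g ∈ off f := by rw [mem_off]; simpa using hgf
  have gx : ∀ i, g ⬝ᵥ (![x, y, z] i) = 0 := (Finset.mem_filter.1 hg).2
  have p3 : 3 ≤ mm (sec C f) g := by
    rw [← sec_card]
    have : 2 < (sec (sec C f) g).card := Finset.two_lt_card_iff.2
      ⟨x, y, z, Finset.mem_filter.2 ⟨hx, gx 0⟩, Finset.mem_filter.2 ⟨hy, gx 1⟩,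
        Finset.mem_filter.2 ⟨hz, gx 2⟩, hxy, hxz, hyz⟩
    omega
  have p4 := p_le h hf hgo
  have pen := pencil C f g
  have l1 := solid_le h (mem_off.1 hgo).1
  have l2 := solid_le h (mem_off.1 (off_add hgo)).1
  have l3 := solid_le h (mem_off.1 (off_sub hgo)).1
  have t1 := ten' h hf hgo
  have t2 := ten' h hf (off_add hgo)
  have t3 := ten' h hf (off_sub hgo)
  rw [mm_sec_add] at t2
  rw [mm_sec_sub] at t3
  rw [hC] at pen
  omega

/-- the test function -/
def uu (h : ℤ) : ℤ := (h - 8) * (h - 9)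

lemma uu_nonneg (h : ℤ) : 0 ≤ uu h := by
  unfold uu
  by_cases h8 : h ≤ 8
  · nlinarith
  · nlinarith [show 9 ≤ h by omega]

lemma U_tot {C : Finset V5} (h : IsCap C) (hC : C.card = 23) : ∑ g : V5, uu (mm C g) = 1350 := by
  have h1 := M1 h
  have h2 := M2 h
  rw [hC] at h1 h2
  have : ∑ g : V5, uu (mm C g) =
      (∑ g : V5, mm C g ^ 2) - 17 * (∑ g : V5, mm C g) + 72 * (∑ g : V5, 1) := by
    rw [Finset.mul_sum, Finset.mul_sum, ← Finset.sum_sub_distrib, ← Finset.sum_add_distrib]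
    apply Finset.sum_congr rfl
    intros; unfold uu; ring
  rw [this, h1, h2]
  simp

lemma U_pt {C : Finset V5} (h : IsCap C) (hC : C.card = 23) {x : V5} (hx : x ∈ C) :
    ∑ g : V5, Iz (g ⬝ᵥ x) * uu (mm C g) = 378 := by
  have h0 := N1 h hx
  have h1 := Q1 h hx
  have h2 := Q2 h hx
  rw [hC] at h1 h2
  have : ∑ g : V5, Iz (g ⬝ᵥ x) * uu (mm C g) =
      (∑ g : V5, Iz (g ⬝ᵥ x) * mm C g ^ 2) - 17 * (∑ g : V5, Iz (g ⬝ᵥ x) * mm C g)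
        + 72 * (∑ g : V5, Iz (g ⬝ᵥ x)) := by
    rw [Finset.mul_sum, Finset.mul_sum, ← Finset.sum_sub_distrib, ← Finset.sum_add_distrib]
    apply Finset.sum_congr rfl
    intros; unfold uu; ring
  rw [this, h0, h1, h2]
  norm_num

lemma U_cub {C : Finset V5} (h : IsCap C) (hC : C.card = 23) :
    ∑ g : V5, uu (mm C g) * (mm C g - 5) = 1944 := by
  have h1 := M1 h
  have h2 := M2 h
  have h3 := M3 h
  rw [hC] at h1 h2 h3
  have : ∑ g : V5, uu (mm C g) * (mm C g - 5) =
      (∑ g : V5, mm C g ^ 3) - 22 * (∑ g : V5, mm C g ^ 2) + 157 * (∑ g : V5, mm C g)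
        - 360 * (∑ g : V5, 1) := by
    rw [Finset.mul_sum, Finset.mul_sum, Finset.mul_sum, ← Finset.sum_sub_distrib,
      ← Finset.sum_add_distrib, ← Finset.sum_sub_distrib]
    apply Finset.sum_congr rfl
    intros; unfold uu; ring
  rw [this, h1, h2, h3]
  simp

lemma sum_off_shift (f : V5) (F : V5 → ℤ) :
    3 * ∑ g ∈ off f, F g = ∑ g ∈ off f, (F g + F (g + f) + F (g - f)) := by
  have h1 : ∑ g ∈ off f, F (g + f) = ∑ g ∈ off f, F g := by
    apply Finset.sum_bij' (fun g _ => g + f) (fun g _ => g - f)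
    · exact fun g hg => off_add hg
    · exact fun g hg => off_sub hg
    · simp
    · simp
    · simp
  have h2 : ∑ g ∈ off f, F (g - f) = ∑ g ∈ off f, F g := by
    apply Finset.sum_bij' (fun g _ => g - f) (fun g _ => g + f)
    · exact fun g hg => off_sub hg
    · exact fun g hg => off_add hg
    · simp
    · simp
    · simp
  rw [Finset.sum_add_distrib, Finset.sum_add_distrib, h1, h2]
  ring

lemma uu_le {m : ℤ} (h5 : 5 ≤ m) (h9 : m ≤ 9) : uu m ≤ 3 * (9 - m) := by
  unfold uu
  interval_cases m <;> norm_num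

/-- No small solids. -/
lemma no_small {C : Finset V5} (h : IsCap C) (hC : C.card = 23) {f : V5} (hf : f ≠ 0) :
    5 ≤ mm C f := by
  by_contra hc
  have hs : mm C f ≤ 2 := small h hC hf (by omega)
  have hnn := mm_nonneg C f
  -- sum over planes without points of C
  let F : V5 → ℤ := fun g => if mm (sec C f) g = 0 then uu (mm C g) else 0
  have A1 : 3 * ∑ g ∈ off f, F g ≤ ∑ g ∈ off f, (3 * (4 + mm C f)) *
      (if mm (sec C f) g = 0 then 1 else 0) := by
    rw [sum_off_shift]
    apply Finset.sum_le_sum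
    intro g hg
    simp only [F, mm_sec_add, mm_sec_sub]
    split_ifs with hp
    · have pen := pencil C f g
      rw [hp, hC] at pen
      have l1 := solid_le h (mem_off.1 hg).1
      have l2 := solid_le h (mem_off.1 (off_add hg)).1
      have l3 := solid_le h (mem_off.1 (off_sub hg)).1
      have t1 := ten' h hf hg
      have t2 := ten' h hf (off_add hg)
      have t3 := ten' h hf (off_sub hg)
      rw [mm_sec_add] at t2
      rw [mm_sec_sub] at t3
      have s1 := small h hC (mem_off.1 hg).1
      have s2 := small h hC (mem_off.1 (off_add hg)).1
      have s3 := small h hC (mem_off.1 (off_sub hg)).1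
      have u1 := uu_le (m := mm C g) (by omega) (by omega)
      have u2 := uu_le (m := mm C (g + f)) (by omega) (by omega)
      have u3 := uu_le (m := mm C (g - f)) (by omega) (by omega)
      push_cast at pen
      linarith
    · simp
  have A2 : 2 * ∑ g ∈ off f, (if mm (sec C f) g = 0 then (1 : ℤ) else 0) ≤
      24 * mm C f ^ 2 - 180 * mm C f + 480 := by
    have e : ∑ g ∈ off f, (1 - mm (sec C f) g) * (2 - mm (sec C f) g) =
        24 * mm C f ^ 2 - 180 * mm C f + 480 := by
      have : ∑ g ∈ off f, (1 - mm (sec C f) g) * (2 - mm (sec C f) g) =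
        (∑ g ∈ off f, mm (sec C f) g ^ 2) - 3 * (∑ g ∈ off f, mm (sec C f) g)
        + 2 * (∑ g ∈ off f, 1) := by
        rw [Finset.mul_sum, Finset.mul_sum, ← Finset.sum_sub_distrib, ← Finset.sum_add_distrib]
        apply Finset.sum_congr rfl
        intros; ring
      rw [this, M1o h hf, M2o h hf, M0o hf]; ring
    rw [← e, Finset.mul_sum]
    apply Finset.sum_le_sum
    intro g hg
    split_ifs with hp
    · rw [hp]; norm_num
    · have b := mm_nonneg (sec C f) g
      by_cases h1 : mm (sec C f) g = 1
      · rw [h1]; norm_num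
      · have : 2 ≤ mm (sec C f) g := by omega
        nlinarith
  have tot := U_tot h hC
  rw [sum_off hf, mm_zero, mm_neg, hC] at tot
  have A3 : ∑ g ∈ off f, uu (mm C g) ≤ ∑ g ∈ off f, F g +
      ∑ x ∈ sec C f, ∑ g ∈ off f, Iz (g ⬝ᵥ x) * uu (mm C g) := by
    rw [Finset.sum_comm, ← Finset.sum_add_distrib]
    apply Finset.sum_le_sum
    intro g hg
    rw [← Finset.sum_mul]
    change _ ≤ F g + mm (sec C f) g * uu (mm C g)
    have b := mm_nonneg (sec C f) g
    have u0 := uu_nonneg (mm C g)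
    simp only [F]
    split_ifs with hp
    · rw [hp]; simp
    · have : 1 ≤ mm (sec C f) g := by omega
      nlinarith
  have A4 : ∑ x ∈ sec C f, ∑ g ∈ off f, Iz (g ⬝ᵥ x) * uu (mm C g) =
      mm C f * (168 - 2 * uu (mm C f)) := by
    rw [← sec_card C f, ← nsmul_eq_mul, ← Finset.sum_const, sec_card C f]
    apply Finset.sum_congr rfl
    intro x hx
    have hx' := Finset.mem_filter.1 hx
    have := U_pt h hC hx'.1
    rw [sum_off hf, mm_zero, mm_neg, hC, neg_dotProduct, hx'.2] at this
    simp [Iz] at this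
    simp [Iz]
    norm_num [uu] at this ⊢
    linarith
  rw [A4] at A3
  rw [← Finset.mul_sum] at A1
  generalize ∑ g ∈ off f, F g = a at *
  generalize ∑ g ∈ off f, (if mm (sec C f) g = 0 then (1 : ℤ) else 0) = b at *
  generalize ∑ g ∈ off f, uu (mm C g) = c at *
  generalize mm C f = m at *
  norm_num [uu] at tot A3
  interval_cases m <;> norm_num at * <;> linarith

theorem cap_le {C : Finset V5} (h : IsCap C) : C.card ≤ 22 := by
  by_contra hc
  obtain ⟨D, hD, hDc⟩ := Finset.exists_subset_card_eq (show 23 ≤ C.card by omega)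
  have hcap := h.mono hD
  have h1 := U_cub hcap hDc
  rw [← Finset.add_sum_erase _ _ (Finset.mem_univ (0 : V5)), mm_zero, hDc] at h1
  have h2 : 0 ≤ ∑ g ∈ Finset.univ.erase (0 : V5), uu (mm D g) * (mm D g - 5) := by
    apply Finset.sum_nonneg
    intro g hg
    have := no_small hcap hDc (Finset.ne_of_mem_erase hg)
    exact mul_nonneg (uu_nonneg _) (by linarith)
  norm_num [uu] at h1
  norm_num [uu] at h2
  linarith

lemma lift_cons {α β : Type*} (f : α → β) {S : Multiset α} {a : β} {t : Multiset β}
    (h : a ::ₘ t ≤ S.map f) : ∃ x S', S = x ::ₘ S' ∧ f x = a ∧ t ≤ S'.map f := by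
  have ha : a ∈ S.map f := Multiset.mem_of_le h (Multiset.mem_cons_self _ _)
  obtain ⟨x, hx, hxa⟩ := Multiset.mem_map.1 ha
  obtain ⟨S', hS'⟩ := Multiset.exists_cons_of_mem hx
  refine ⟨x, S', hS', hxa, ?_⟩
  rw [hS', Multiset.map_cons, hxa] at h
  exact (Multiset.cons_le_cons_iff a).1 h

lemma lift_le {α β : Type*} (f : α → β) (t : Multiset β) : ∀ (S : Multiset α),
    t ≤ S.map f → ∃ t' ≤ S, t'.map f = t := by
  induction t using Multiset.induction with
  | empty => intro S _; exact ⟨0, Multiset.zero_le _, rfl⟩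
  | cons a t ih =>
    intro S h
    obtain ⟨x, S', rfl, rfl, h'⟩ := lift_cons f h
    obtain ⟨t', ht', rfl⟩ := ih S' h'
    exact ⟨x ::ₘ t', (Multiset.cons_le_cons_iff x).2 ht', by simp⟩

lemma lift_add {α β : Type*} (f : α → β) {t₁ t₂ : Multiset β} {S : Multiset α}
    (h : t₁ + t₂ ≤ S.map f) : ∃ s₁ s₂, s₁ + s₂ ≤ S ∧ s₁.map f = t₁ ∧ s₂.map f = t₂ := by
  obtain ⟨T, hT, hm⟩ := lift_le f _ _ h
  obtain ⟨s₁, hs₁, rfl⟩ := lift_le f t₁ T (by rw [hm]; exact Multiset.le_add_right _ _)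
  obtain ⟨s₂, rfl⟩ := Multiset.le_iff_exists_add.1 hs₁
  refine ⟨s₁, s₂, hT, rfl, ?_⟩
  simpa using hm

/-- canonical representative up to sign -/
lemma exists_rep : ∃ r : V5 → V5, (∀ x, r x = x ∨ r x = -x) ∧ ∀ x, r (-x) = r x := by
  let q : V5 → Sym2 V5 := fun x => s(x, -x)
  refine ⟨fun x => Function.invFun q (q x), fun x => ?_, fun x => ?_⟩
  · have : q (Function.invFun q (q x)) = q x := Function.invFun_eq ⟨x, rfl⟩
    simp only [q, Sym2.eq_iff] at this
    tauto
  · have : q (-x) = q x := by simp [q, Sym2.eq_swap]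
    simp only [this]

lemma base_can (S : Multiset V5)
    (hc : ∀ x ∈ S, ∀ y ∈ S, x = -y → x = y)
    (H : ∀ x y z, x ::ₘ y ::ₘ z ::ₘ 0 ≤ S →
      x + y + z ≠ 0 ∧ x + y - z ≠ 0 ∧ x - y + z ≠ 0 ∧ x - y - z ≠ 0) : Multiset.card S < 45 := by
  have key : ∀ C : Finset V5, C ⊆ S.toFinset → 0 ∉ C → C.card ≤ 22 := by
    intro C hC h0
    apply cap_le
    refine ⟨fun x hx h => h0 (h ▸ hx), fun x hx y hy hxy h => hxy
      (hc x (Multiset.mem_toFinset.1 (hC hx)) y (Multiset.mem_toFinset.1 (hC hy)) h), ?_⟩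
    intro x hx y hy z hz h1 h2 h3
    apply H
    apply (Multiset.le_iff_subset _).2
    · intro w hw
      simp at hw
      rcases hw with rfl | rfl | rfl
      · exact Multiset.mem_toFinset.1 (hC hx)
      · exact Multiset.mem_toFinset.1 (hC hy)
      · exact Multiset.mem_toFinset.1 (hC hz)
    · simp [h1, h2, h3]
  have c2 : ∀ x, S.count x ≤ 2 := by
    intro x
    by_contra hx
    have : Multiset.replicate 3 x ≤ S := Multiset.le_count_iff_replicate_le.1 (by omega)
    exact (H x x x this).1 (three5 x)
  have hcard := Multiset.toFinset_sum_count_eq S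
  by_cases h0 : (0 : V5) ∈ S
  · have c1 : ∀ x ≠ 0, S.count x ≤ 1 := by
      intro x hx
      by_contra hx2
      have : 0 ::ₘ x ::ₘ x ::ₘ 0 ≤ S := by
        rw [Multiset.le_iff_count]
        intro a
        have := Multiset.count_pos.2 h0
        by_cases e0 : a = 0
        · subst e0; simp [Ne.symm hx]; omega
        · by_cases ex : a = x
          · subst ex; simp [hx]; omega
          · simp [e0, ex]
      exact (H 0 x x this).2.1 (by simp)
    have hk := key (S.toFinset.erase 0) (Finset.erase_subset _ _) (Finset.notMem_erase _ _)
    rw [← Finset.add_sum_erase _ _ (Multiset.mem_toFinset.2 h0)] at hcard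
    have := Finset.sum_le_card_nsmul (S.toFinset.erase 0) (fun x => S.count x) 1
      (fun x hx => c1 x (Finset.ne_of_mem_erase hx))
    have := c2 0
    simp only [smul_eq_mul] at *
    omega
  · have hk := key S.toFinset subset_rfl (by simpa using h0)
    have := Finset.sum_le_card_nsmul S.toFinset (fun x => S.count x) 2 (fun x _ => c2 x)
    simp only [smul_eq_mul] at *
    omega

lemma base (S : Multiset V5) (hS : 45 ≤ Multiset.card S) : HasWZSS S 3 := by
  by_contra hW
  obtain ⟨r, hr1, hr2⟩ := exists_rep
  have H : ∀ x y z, x ::ₘ y ::ₘ z ::ₘ 0 ≤ S →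
      x + y + z ≠ 0 ∧ x + y - z ≠ 0 ∧ x - y + z ≠ 0 ∧ x - y - z ≠ 0 := by
    intro x y z h
    refine ⟨fun e => hW ⟨{x, y, z}, 0, by simpa using h, by simp, by simp [← e, add_assoc]⟩,
      fun e => hW ⟨{x, y}, {z}, ?_, by simp, by simpa [sub_eq_zero] using e⟩,
      fun e => hW ⟨{x, z}, {y}, ?_, by simp, ?_⟩,
      fun e => hW ⟨{x}, {y, z}, ?_, by simp, ?_⟩⟩
    · simpa using h
    · refine le_trans (le_of_eq ?_) h
      simp only [← Multiset.singleton_add, Multiset.insert_eq_cons]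
      abel
    · simp
      grind
    · refine le_trans (le_of_eq ?_) h
      simp only [← Multiset.singleton_add, Multiset.insert_eq_cons]
      abel
    · simp
      grind
  have := base_can (S.map r) ?_ ?_
  · rw [Multiset.card_map] at this
    omega
  · intro x hx y hy hxy
    obtain ⟨x', -, rfl⟩ := Multiset.mem_map.1 hx
    obtain ⟨y', -, rfl⟩ := Multiset.mem_map.1 hy
    have : x' = y' ∨ x' = -y' := by
      have := hr1 x'
      have := hr1 y'
      grind
    rcases this with rfl | rfl
    · rfl
    · rw [hr2]
  · intro a b c h
    obtain ⟨x, S1, rfl, rfl, h1⟩ := lift_cons r h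
    obtain ⟨y, S2, rfl, rfl, h2⟩ := lift_cons r h1
    obtain ⟨z, S3, rfl, rfl, h3⟩ := lift_cons r h2
    have hh := H x y z (by simp)
    rcases hr1 x with e1 | e1 <;> rcases hr1 y with e2 | e2 <;> rcases hr1 z with e3 | e3 <;>
      rw [e1, e2, e3] <;> grind

abbrev Z5 := Fin 5 → ℤ

/-- weighted zero-sum subsequence modulo `3 ^ a`, over the integers -/
def ZW (a : ℕ) (S : Multiset Z5) : Prop :=
  ∃ t₁ t₂ : Multiset Z5, t₁ + t₂ ≤ S ∧ Multiset.card (t₁ + t₂) = 3 ^ a ∧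
    ∃ w : Z5, t₁.sum = t₂.sum + (3 ^ a : ℤ) • w

/-- reduction map -/
def red (n : ℕ) : Z5 →+ (Fin 5 → ZMod n) where
  toFun x := fun i => (x i : ZMod n)
  map_zero' := by ext; simp
  map_add' x y := by ext; simp

lemma base_int (S : Multiset Z5) (hS : 45 ≤ Multiset.card S) : ZW 1 S := by
  obtain ⟨u₁, u₂, h1, h2, h3⟩ := base (S.map (red 3)) (by simpa using hS)
  obtain ⟨t₁, t₂, h4, rfl, rfl⟩ := lift_add _ h1
  refine ⟨t₁, t₂, h4, by simpa using h2, ?_⟩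
  rw [← map_multiset_sum, ← map_multiset_sum] at h3
  have : ∀ i, ∃ c, t₁.sum i = t₂.sum i + 3 * c := by
    intro i
    have := congrFun h3 i
    change ((t₁.sum i : ℤ) : ZMod 3) = ((t₂.sum i : ℤ) : ZMod 3) at this
    rw [ZMod.intCast_eq_intCast_iff_dvd_sub] at this
    obtain ⟨c, hc⟩ := this
    exact ⟨-c, by push_cast at hc; linarith⟩
  choose w hw using this
  exact ⟨w, by ext i; simp [hw]⟩

/-- extraction of many blocks -/
lemma extract (n : ℕ) : ∀ S : Multiset Z5, 3 * n + 42 ≤ Multiset.card S →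
    ∃ P : Multiset (Multiset Z5 × Multiset Z5 × Z5), Multiset.card P = n ∧
      (P.map (fun p => p.1 + p.2.1)).sum ≤ S ∧
      ∀ p ∈ P, Multiset.card p.1 + Multiset.card p.2.1 = 3 ∧ p.1.sum = p.2.1.sum + (3 : ℤ) • p.2.2 := by
  induction n with
  | zero => intro S _; exact ⟨0, by simp⟩
  | succ n ih =>
    intro S hS
    obtain ⟨t₁, t₂, h1, h2, w, h3⟩ := base_int S (by omega)
    obtain ⟨R, rfl⟩ := Multiset.le_iff_exists_add.1 h1
    rw [Multiset.card_add, h2] at hS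
    obtain ⟨P, hP1, hP2, hP3⟩ := ih R (by omega)
    refine ⟨(t₁, t₂, w) ::ₘ P, by simp [hP1], ?_, ?_⟩
    · simp only [Multiset.map_cons, Multiset.sum_cons]
      gcongr
    · intro p hp
      rcases Multiset.mem_cons.1 hp with rfl | hp
      · exact ⟨by simpa using h2, by simpa using h3⟩
      · exact hP3 p hp

lemma block_sums (P : Multiset (Multiset Z5 × Multiset Z5 × Z5))
    (h : ∀ p ∈ P, Multiset.card p.1 + Multiset.card p.2.1 = 3 ∧
      p.1.sum = p.2.1.sum + (3 : ℤ) • p.2.2) :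
    Multiset.card (P.map (fun p : Multiset Z5 × Multiset Z5 × Z5 => p.1)).sum + Multiset.card (P.map (fun p : Multiset Z5 × Multiset Z5 × Z5 => p.2.1)).sum
      = 3 * Multiset.card P ∧
    (P.map (fun p : Multiset Z5 × Multiset Z5 × Z5 => p.1)).sum.sum =
      (P.map (fun p : Multiset Z5 × Multiset Z5 × Z5 => p.2.1)).sum.sum + (3 : ℤ) • (P.map (fun p : Multiset Z5 × Multiset Z5 × Z5 => p.2.2)).sum := by
  induction P using Multiset.induction with
  | empty => simp
  | cons p P ih =>
    obtain ⟨i1, i2⟩ := ih (fun q hq => h q (Multiset.mem_cons_of_mem hq))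
    obtain ⟨j1, j2⟩ := h p (Multiset.mem_cons_self _ _)
    simp only [Multiset.map_cons, Multiset.sum_cons, Multiset.card_add, Multiset.card_cons,
      Multiset.sum_add]
    refine ⟨by omega, ?_⟩
    rw [i2, j2, smul_add]
    abel

lemma upper_int (a : ℕ) (ha : 1 ≤ a) : ∀ S : Multiset Z5,
    22 * 3 ^ a - 21 ≤ Multiset.card S → ZW a S := by
  induction a, ha using Nat.le_induction with
  | base => intro S hS; exact base_int S (by simpa using hS)
  | succ a ha ih =>
    intro S hS
    have hp : 1 ≤ 3 ^ a := Nat.one_le_pow _ _ (by norm_num)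
    obtain ⟨P, hP1, hP2, hP3⟩ := extract (22 * 3 ^ a - 21) S (by rw [pow_succ] at hS; omega)
    obtain ⟨u₁, u₂, h1, h2, w, h3⟩ := ih (P.map (fun p => p.2.2)) (by simp [hP1])
    obtain ⟨P₁, P₂, h4, rfl, rfl⟩ := lift_add _ h1
    obtain ⟨R, rfl⟩ := Multiset.le_iff_exists_add.1 h4
    obtain ⟨a1, a2⟩ := block_sums P₁ (fun p hp => hP3 p (by simp [hp]))
    obtain ⟨b1, b2⟩ := block_sums P₂ (fun p hp => hP3 p (by simp [hp]))
    refine ⟨(P₁.map (fun p => p.1)).sum + (P₂.map (fun p => p.2.1)).sum,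
      (P₁.map (fun p => p.2.1)).sum + (P₂.map (fun p => p.1)).sum, ?_, ?_, w, ?_⟩
    · refine le_trans ?_ hP2
      simp only [Multiset.map_add, Multiset.sum_add, Multiset.sum_map_add]
      refine le_trans (le_of_eq ?_) (Multiset.le_add_right _ _)
      abel
    · simp only [Multiset.card_add, Multiset.card_map] at h2 ⊢
      rw [pow_succ]
      omega
    · rw [Multiset.sum_add, Multiset.sum_add, a2, b2, h3, smul_add, smul_smul, pow_succ']
      abel

lemma upper (a : ℕ) (ha : 1 ≤ a) (S : Multiset (Fin 5 → ZMod (3 ^ a)))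
    (hS : 22 * 3 ^ a - 21 ≤ Multiset.card S) : HasWZSS S (3 ^ a) := by
  have : NeZero (3 ^ a) := ⟨by positivity⟩
  let l : (Fin 5 → ZMod (3 ^ a)) → Z5 := fun x i => ((x i).val : ℤ)
  have hl : ∀ x, red (3 ^ a) (l x) = x := by
    intro x; ext i; simp [red, l]
  obtain ⟨t₁, t₂, h1, h2, w, h3⟩ := upper_int a ha (S.map l) (by simpa using hS)
  refine ⟨t₁.map (red _), t₂.map (red _), ?_, by simpa using h2, ?_⟩
  · rw [← Multiset.map_add]
    refine le_trans (Multiset.map_le_map h1) (le_of_eq ?_)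
    rw [Multiset.map_map]
    simp [hl]
  · rw [← map_multiset_sum, ← map_multiset_sum, h3, map_add]
    convert add_zero _
    ext i
    simp only [red, AddMonoidHom.coe_mk, ZeroHom.coe_mk, Pi.smul_apply, smul_eq_mul,
      Pi.zero_apply]
    push_cast
    have : ((3 ^ a : ℕ) : ZMod (3 ^ a)) = 0 := ZMod.natCast_self _
    push_cast at this
    rw [this, zero_mul]

/-- vectors of the extremal example -/
def ext5 (n : ℕ) (b : Fin 4 → Bool) : Fin 5 → ZMod n :=
  Fin.snoc (α := fun _ => ZMod n) (fun i => if b i then 1 else 0) 1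

lemma msum_apply {n : ℕ} (B : Multiset (Fin 5 → ZMod n)) (i : Fin 5) :
    B.sum i = (B.map (fun x => x i)).sum :=
  map_multiset_sum (Pi.evalAddMonoidHom (fun _ : Fin 5 => ZMod n) i) B

lemma sum_bool_map {β : Type*} (n : ℕ) (B : Multiset β) (f : β → Bool) :
    (B.map (fun b => if f b then (1 : ZMod n) else 0)).sum
      = ((Multiset.card (B.filter (fun b => f b = true)) : ℕ) : ZMod n) := by
  induction B using Multiset.induction with
  | empty => simp
  | cons b B ih =>
    by_cases h : f b <;> simp [h, ih, add_comm]

lemma no_zero_sum (n : ℕ) (hn : 2 ≤ n) (B : Multiset (Fin 4 → Bool))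
    (hB : B ≤ (n - 1) • (Finset.univ : Finset (Fin 4 → Bool)).val) (hc : Multiset.card B = n)
    (hs : (B.map (ext5 n)).sum = 0) : False := by
  have h1 : ∀ i : Fin 4, ∀ b ∈ B, ∀ b' ∈ B, b i = b' i := by
    intro i
    have e := congrFun hs (Fin.castSucc i)
    rw [msum_apply, Multiset.map_map] at e
    simp only [Function.comp_def, ext5, Fin.snoc_castSucc, Pi.zero_apply] at e
    rw [sum_bool_map n B (fun b => b i), ZMod.natCast_eq_zero_iff] at e
    have hle := Multiset.card_le_card (Multiset.filter_le (fun b : Fin 4 → Bool => b i = true) B)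
    rw [hc] at hle
    rcases Nat.eq_zero_or_pos (Multiset.card (B.filter (fun b => b i = true))) with h0 | h0
    · rw [Multiset.card_eq_zero, Multiset.filter_eq_nil] at h0
      intro b hb b' hb'
      have := h0 b hb
      have := h0 b' hb'
      simp_all
    · have h2 : Multiset.card (B.filter (fun b => b i = true)) = n :=
        le_antisymm hle (Nat.le_of_dvd h0 e)
      have h3 := Multiset.eq_of_le_of_card_le (Multiset.filter_le (fun b => b i = true) B)
        (by rw [h2, hc])
      rw [Multiset.filter_eq_self] at h3
      intro b hb b' hb'
      rw [h3 b hb, h3 b' hb']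
  have hpos : 0 < Multiset.card B := by omega
  obtain ⟨b, hb⟩ := Multiset.card_pos_iff_exists_mem.1 hpos
  have h2 : B = Multiset.replicate n b := by
    rw [Multiset.eq_replicate]
    exact ⟨hc, fun b' hb' => funext fun i => h1 i b' hb' b hb⟩
  have h3 := Multiset.count_le_of_le b hB
  rw [h2, Multiset.count_replicate_self, Multiset.count_nsmul] at h3
  have h4 : (Finset.univ : Finset (Fin 4 → Bool)).val.count b ≤ 1 :=
    Multiset.nodup_iff_count_le_one.1 Finset.univ.nodup b
  have : (n - 1) * (Finset.univ : Finset (Fin 4 → Bool)).val.count b ≤ (n - 1) * 1 :=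
    Nat.mul_le_mul_left _ h4
  omega

lemma lower (n : ℕ) (hn : 2 ≤ n) (hodd : Odd n) :
    ∃ S : Multiset (Fin 5 → ZMod n), Multiset.card S = 16 * n - 16 ∧ ¬ HasWZSS S n := by
  refine ⟨((n - 1) • (Finset.univ : Finset (Fin 4 → Bool)).val).map (ext5 n), ?_, ?_⟩
  · simp
    omega
  · rintro ⟨t₁, t₂, h1, h2, h3⟩
    obtain ⟨B₁, B₂, h4, rfl, rfl⟩ := lift_add _ h1
    have e := congrFun h3 (Fin.last 4)
    rw [msum_apply, Multiset.map_map, msum_apply, Multiset.map_map] at e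
    simp only [Function.comp_def, ext5, Fin.snoc_last, Multiset.map_const', Multiset.sum_replicate,
      nsmul_eq_mul, mul_one] at e
    simp only [Multiset.card_add, Multiset.card_map] at h2
    have hd : n ∣ 2 * Multiset.card B₁ := by
      rw [← ZMod.natCast_eq_zero_iff]
      have : ((Multiset.card B₁ + Multiset.card B₂ : ℕ) : ZMod n) = 0 := by
        rw [h2]; exact ZMod.natCast_self n
      push_cast at this ⊢
      rw [← e] at this
      rw [two_mul]; exact this
    have hd' : n ∣ Multiset.card B₁ :=
      (Nat.Coprime.dvd_of_dvd_mul_left (Nat.coprime_two_right.2 hodd) hd)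
    rcases Nat.eq_zero_or_pos (Multiset.card B₁) with h0 | h0
    · rw [Multiset.card_eq_zero.1 h0] at h3 h4
      exact no_zero_sum n hn B₂ (by simpa using h4) (by omega) (by simpa using h3.symm)
    · have := Nat.le_of_dvd h0 hd'
      have h5 : Multiset.card B₂ = 0 := by omega
      rw [Multiset.card_eq_zero.1 h5] at h3 h4
      exact no_zero_sum n hn B₁ (by simpa using h4) (by omega) (by simpa using h3)

lemma exp5 (n : ℕ) : AddMonoid.exponent (Fin 5 → ZMod n) = n := by
  rw [AddMonoid.exponent_pi]
  simp only [ZMod.exponent]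
  exact Nat.dvd_antisymm (Finset.lcm_dvd fun _ _ => dvd_rfl)
    (Finset.dvd_lcm (f := fun _ : Fin 5 => n) (Finset.mem_univ 0))

theorem sA_three_pow_fifth (a : ℕ) (ha : 1 ≤ a) :
    (16 * 3 ^ a - 15 ≤ sA (Fin 5 → ZMod (3 ^ a)) ∧
      sA (Fin 5 → ZMod (3 ^ a)) ≤ 22 * 3 ^ a - 21) ∧
    (∀ S : Multiset (Fin 5 → ZMod (3 ^ a)),
      22 * 3 ^ a - 21 ≤ Multiset.card S → HasWZSS S (3 ^ a)) ∧
    ∃ S : Multiset (Fin 5 → ZMod (3 ^ a)),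
      Multiset.card S = 16 * 3 ^ a - 16 ∧ ¬ HasWZSS S (3 ^ a) := by
  have hn : 3 ≤ 3 ^ a := by
    calc 3 = 3 ^ 1 := by norm_num
      _ ≤ 3 ^ a := Nat.pow_le_pow_right (by norm_num) ha
  have hu := upper a ha
  have hl := lower (3 ^ a) (by omega) (Odd.pow (by decide))
  have hmem : 22 * 3 ^ a - 21 ∈ {ℓ : ℕ | ∀ S : Multiset (Fin 5 → ZMod (3 ^ a)),
      ℓ ≤ Multiset.card S → HasWZSS S (AddMonoid.exponent (Fin 5 → ZMod (3 ^ a)))} := by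
    intro S hS
    rw [exp5]
    exact hu S hS
  refine ⟨⟨?_, Nat.sInf_le hmem⟩, hu, hl⟩
  refine le_csInf ⟨_, hmem⟩ ?_
  intro ℓ hℓ
  obtain ⟨S, hS, hS'⟩ := hl
  by_contra hc
  apply hS'
  have := hℓ S (by omega)
  rwa [exp5] at this
end

section
/- Let A = {−1,1}, let G be a finite abelian group and H a subgroup of G. Every sequence over G of length at least (s_A(H) − 1)·exp(G/H) + s_A(G/H) has an A-zero-sum subsequence of length exp(H)·exp(G/H). In particular, if exp(G) = exp(H)·exp(G/H), then s_A(G) ≤ (s_A(H) − 1)·exp(G/H) + s_A(G/H). -/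
theorem wz_map_split {α β : Type*} (f : α → β) (a b : Multiset β) :
    ∀ T : Multiset α, T.map f = a + b → ∃ A B, T = A + B ∧ A.map f = a ∧ B.map f = b := by
  classical
  induction a using Multiset.induction_on with
  | empty => intro T h; exact ⟨0, T, by simp, by simp, by simpa using h⟩
  | cons x a ih =>
    intro T h
    rw [Multiset.cons_add] at h
    have hx : x ∈ T.map f := by rw [h]; simp
    obtain ⟨y, hy, rfl⟩ := Multiset.mem_map.1 hx
    obtain ⟨T', rfl⟩ := Multiset.exists_cons_of_mem hy
    rw [Multiset.map_cons, Multiset.cons_inj_right] at h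
    obtain ⟨A, B, rfl, hA, hB⟩ := ih T' h
    exact ⟨y ::ₘ A, B, by simp, by simp [hA], hB⟩

theorem sA_mem (G : Type*) [AddCommGroup G] [Finite G] (S : Multiset G)
    (h : sA G ≤ Multiset.card S) : HasWZSS S (AddMonoid.exponent G) := by
  classical
  have := Fintype.ofFinite G
  have hne : {ℓ : ℕ | ∀ S : Multiset G, ℓ ≤ Multiset.card S →
      HasWZSS S (AddMonoid.exponent G)}.Nonempty := by
    refine ⟨Fintype.card G * AddMonoid.exponent G, fun S hS => ?_⟩
    have h1 : ∑ g : G, S.count g = Multiset.card S :=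
      Multiset.sum_count_eq_card (fun _ _ => Finset.mem_univ _)
    have : ∃ g ∈ (Finset.univ : Finset G), AddMonoid.exponent G ≤ S.count g := by
      apply Finset.exists_le_of_sum_le ⟨0, Finset.mem_univ _⟩
      rw [h1]; simpa using hS
    obtain ⟨g, -, hg⟩ := this
    refine ⟨Multiset.replicate (AddMonoid.exponent G) g, 0, ?_, by simp, ?_⟩
    · simpa using Multiset.le_count_iff_replicate_le.1 hg
    · simp [AddMonoid.exponent_nsmul_eq_zero]
  exact Nat.sInf_mem hne S h

theorem wz_extract {G : Type*} [AddCommGroup G] [Finite G] (H : AddSubgroup G) (m : ℕ) :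
    ∀ S : Multiset G, m * AddMonoid.exponent (G ⧸ H) + sA (G ⧸ H) ≤
      Multiset.card S + AddMonoid.exponent (G ⧸ H) →
    ∃ T : Multiset (Multiset G × Multiset G × H), Multiset.card T = m ∧
      (T.map fun p => p.1 + p.2.1).sum ≤ S ∧
      ∀ p ∈ T, Multiset.card (p.1 + p.2.1) = AddMonoid.exponent (G ⧸ H) ∧
        p.1.sum = p.2.1.sum + (p.2.2 : G) := by
  classical
  induction m with
  | zero => intro S _; exact ⟨0, by simp⟩
  | succ m ih =>
    intro S hS
    have h0 : m * AddMonoid.exponent (G ⧸ H) + sA (G ⧸ H) ≤ Multiset.card S := by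
      rw [Nat.succ_mul] at hS; omega
    obtain ⟨u₁, u₂, hle, hc, hs⟩ := sA_mem (G ⧸ H) (S.map (QuotientAddGroup.mk' H))
      (by rw [Multiset.card_map]; omega)
    obtain ⟨w, hw⟩ := Multiset.le_iff_exists_add.1 hle
    obtain ⟨C, W, rfl, hC, -⟩ := wz_map_split _ _ _ S hw
    obtain ⟨A, B, rfl, rfl, rfl⟩ := wz_map_split _ _ _ C hC
    have hAB : Multiset.card (A + B) = AddMonoid.exponent (G ⧸ H) := by simpa using hc
    obtain ⟨T, hT, hTle, hTp⟩ := ih W (by rw [Multiset.card_add] at h0; omega)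
    have hmem : A.sum - B.sum ∈ H := by
      rw [← map_multiset_sum, ← map_multiset_sum] at hs
      rw [← QuotientAddGroup.eq_zero_iff]
      have : QuotientAddGroup.mk' H (A.sum - B.sum) = 0 := by rw [map_sub, hs, sub_self]
      exact this
    refine ⟨(A, B, ⟨_, hmem⟩) ::ₘ T, by simp [hT], ?_, ?_⟩
    · simpa using hTle
    · intro p hp
      rcases Multiset.mem_cons.1 hp with rfl | hp
      · exact ⟨hAB, by simp⟩
      · exact hTp p hp

theorem wz_sum {G : Type*} [AddCommGroup G] {H : AddSubgroup G} (n : ℕ)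
    (T : Multiset (Multiset G × Multiset G × H)) :
    (∀ p ∈ T, Multiset.card (p.1 + p.2.1) = n ∧ p.1.sum = p.2.1.sum + (p.2.2 : G)) →
    (T.map fun p => p.1 + p.2.1).sum = (T.map fun p => p.1).sum + (T.map fun p => p.2.1).sum ∧
    Multiset.card (T.map fun p => p.1 + p.2.1).sum = Multiset.card T * n ∧
    Multiset.sum (T.map fun p => p.1).sum =
      Multiset.sum (T.map fun p => p.2.1).sum + ((T.map fun p => p.2.2).sum : H) := by
  induction T using Multiset.induction_on with
  | empty => intro _; simp
  | cons p T ih =>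
    intro h
    obtain ⟨h1, h2, h3⟩ := ih fun q hq => h q (Multiset.mem_cons_of_mem hq)
    obtain ⟨g1, g2⟩ := h p (Multiset.mem_cons_self _ _)
    refine ⟨by simp only [Multiset.map_cons, Multiset.sum_cons, h1]; abel, ?_, ?_⟩
    · rw [Multiset.map_cons, Multiset.sum_cons, Multiset.card_add, h2, g1, Multiset.card_cons]
      ring
    · simp only [Multiset.map_cons, Multiset.sum_cons, Multiset.sum_add, h3, g2,
        AddSubgroup.coe_add]
      abel

theorem wz_main {G : Type*} [AddCommGroup G] [Finite G] (H : AddSubgroup G) (S : Multiset G)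
    (hS : (sA H - 1) * AddMonoid.exponent (G ⧸ H) + sA (G ⧸ H) ≤ Multiset.card S) :
    HasWZSS S (AddMonoid.exponent H * AddMonoid.exponent (G ⧸ H)) := by
  classical
  have hb : sA H * AddMonoid.exponent (G ⧸ H) + sA (G ⧸ H) ≤
      Multiset.card S + AddMonoid.exponent (G ⧸ H) := by
    rcases Nat.eq_zero_or_pos (sA H) with h | h
    · rw [h] at hS ⊢; simp at hS ⊢; omega
    · obtain ⟨k, hk⟩ := Nat.exists_eq_add_of_lt h
      rw [hk] at hS ⊢
      simp only [zero_add, Nat.add_sub_cancel] at hS ⊢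
      rw [Nat.succ_mul]; omega
  obtain ⟨T, hT, hTle, hTp⟩ := wz_extract H (sA H) S hb
  obtain ⟨u₁, u₂, hle, hc, hs⟩ := sA_mem H (T.map fun p => p.2.2) (by simp [hT])
  obtain ⟨w, hw⟩ := Multiset.le_iff_exists_add.1 hle
  obtain ⟨C, W, rfl, hC, -⟩ := wz_map_split _ _ _ T hw
  obtain ⟨A, B, rfl, rfl, rfl⟩ := wz_map_split _ _ _ C hC
  obtain ⟨a1, a2, a3⟩ := wz_sum _ A fun p hp => hTp p (by simp [hp])
  obtain ⟨b1, b2, b3⟩ := wz_sum _ B fun p hp => hTp p (by simp [hp])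
  have e : (A.map fun p => p.1).sum + (B.map fun p => p.2.1).sum +
      ((A.map fun p => p.2.1).sum + (B.map fun p => p.1).sum) =
      (A.map fun p => p.1 + p.2.1).sum + (B.map fun p => p.1 + p.2.1).sum := by
    rw [a1, b1]; abel
  refine ⟨(A.map fun p => p.1).sum + (B.map fun p => p.2.1).sum,
    (A.map fun p => p.2.1).sum + (B.map fun p => p.1).sum, ?_, ?_, ?_⟩
  · rw [e]
    refine le_trans ?_ hTle
    rw [Multiset.map_add, Multiset.map_add, Multiset.sum_add, Multiset.sum_add]
    exact Multiset.le_add_right _ _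
  · rw [e, Multiset.card_add, a2, b2, ← hc, Multiset.card_add, Multiset.card_map,
      Multiset.card_map]
    ring
  · rw [Multiset.sum_add, Multiset.sum_add, a3, b3, hs]
    abel

/-- Proposition 7: let `G` be a finite abelian group and `H ≤ G`.
Every sequence over `G` of length at least `(s_A(H) - 1)·exp(G/H) + s_A(G/H)` has a
`{-1,1}`-zero-sum subsequence of length `exp(H)·exp(G/H)`. In particular, if
`exp(G) = exp(H)·exp(G/H)`, then `s_A(G) ≤ (s_A(H) - 1)·exp(G/H) + s_A(G/H)`. -/
theorem sA_subgroup_quotient (G : Type*) [AddCommGroup G] [Finite G]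
    (H : AddSubgroup G) :
    (∀ S : Multiset G,
      (sA H - 1) * AddMonoid.exponent (G ⧸ H) + sA (G ⧸ H) ≤ Multiset.card S →
        HasWZSS S (AddMonoid.exponent H * AddMonoid.exponent (G ⧸ H))) ∧
    (AddMonoid.exponent G = AddMonoid.exponent H * AddMonoid.exponent (G ⧸ H) →
      sA G ≤ (sA H - 1) * AddMonoid.exponent (G ⧸ H) + sA (G ⧸ H)) := by
  exact ⟨wz_main H, fun h => Nat.sInf_le fun S hS => h ▸ wz_main H S hS⟩
end
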